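/- Let H be an infinite-dimensional separable complex Hilbert space. If there exists a continuous linear map P : L(H) → L(H) with P ∘ P = P whose range is exactly the subspace of compact operators on H, then there exists a continuous linear map ρ : ℓ∞ → ℓ∞ with ρ ∘ ρ = ρ whose range is exactly c₀; that is, if the compact operators are complemented in L(H), then c₀ is complemented in ℓ∞. -/

import Mathlib

open scoped ENNReal

open Filter Topology in
/-- The diagonal coefficients of a compact operator along an orthonormal sequence tend to `0`. -/
theorem IsCompactOperator.tendsto_inner_orthonormal {𝕜 E : Type*} [RCLike 𝕜]
    [NormedAddCommGroup E] [InnerProductSpace 𝕜 E] {T : E →L[𝕜] E}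
    (hT : IsCompactOperator T) {v : ℕ → E} (hv : Orthonormal 𝕜 v) :
    Tendsto (fun n => inner 𝕜 (v n) (T (v n))) atTop (𝓝 0) := by
  obtain ⟨K, hK, hTK⟩ :=
    IsCompactOperator.image_closedBall_subset_compact (f := (T : E →ₗ[𝕜] E)) hT 1
  refine tendsto_of_subseq_tendsto fun ns hns => ?_
  obtain ⟨y, -, φ, hφ, hy⟩ := hK.tendsto_subseq (x := fun n => T (v (ns n))) fun n =>
    hTK ⟨v (ns n), by simp [hv.1], rfl⟩
  refine ⟨φ, ?_⟩
  have hbessel : Tendsto (fun n => inner 𝕜 (v n) y) atTop (𝓝 0) := by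
    have h := (hv.inner_products_summable (x := y)).tendsto_atTop_zero.sqrt
    simp only [Real.sqrt_sq (norm_nonneg _), Real.sqrt_zero] at h
    exact tendsto_zero_iff_norm_tendsto_zero.2 h
  have hdiff : Tendsto (fun n => inner 𝕜 (v (ns (φ n))) (T (v (ns (φ n))) - y)) atTop (𝓝 0) := by
    refine squeeze_zero_norm (fun n => ?_) (tendsto_iff_norm_sub_tendsto_zero.1 hy)
    simpa [hv.1] using norm_inner_le_norm (𝕜 := 𝕜) (v (ns (φ n))) (T (v (ns (φ n))) - y)
  have hsum := hdiff.add (hbessel.comp (hns.comp hφ.tendsto_atTop))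
  simpa [inner_sub_right] using hsum

/-- An infinite-dimensional inner product space contains an orthonormal sequence. -/
theorem exists_orthonormal_nat {𝕜 E : Type*} [RCLike 𝕜] [NormedAddCommGroup E]
    [InnerProductSpace 𝕜 E] (h : ¬ FiniteDimensional 𝕜 E) : ∃ v : ℕ → E, Orthonormal 𝕜 v := by
  let b := Module.Basis.ofVectorSpace 𝕜 E
  have : Infinite (Module.Basis.ofVectorSpaceIndex 𝕜 E) := by
    by_contra hfin
    rw [not_infinite_iff_finite] at hfin
    exact h (Module.Finite.of_basis b)
  exact ⟨_, InnerProductSpace.gramSchmidtNormed_orthonormal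
    (b.linearIndependent.comp _ (Infinite.natEmbedding _).injective)⟩

namespace lp

/-- Multiplication of square-summable sequences by bounded sequences. -/
noncomputable def multiplier :
    lp (fun _ : ℕ => ℂ) ∞ →L[ℂ] lp (fun _ : ℕ => ℂ) 2 →L[ℂ] lp (fun _ : ℕ => ℂ) 2 :=
  holderL (p := ∞) (q := 2) 2 (K := 1) (fun _ => ContinuousLinearMap.mul ℂ ℂ) fun _ => by simp

theorem multiplier_apply (f : lp (fun _ : ℕ => ℂ) ∞) (x : lp (fun _ : ℕ => ℂ) 2) (n : ℕ) :
    multiplier f x n = f n * x n :=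
  rfl

theorem multiplier_single (f : lp (fun _ : ℕ => ℂ) ∞) (n : ℕ) (a : ℂ) :
    multiplier f (lp.single 2 n a) = lp.single 2 n (f n * a) := by
  ext m
  rw [multiplier_apply]
  obtain rfl | h := eq_or_ne m n
  · simp
  · simp [h]

theorem isCompactOperator_multiplier_single (n : ℕ) (a : ℂ) :
    IsCompactOperator (multiplier (lp.single ∞ n a)) := by
  have h : multiplier (lp.single ∞ n a) =
      (singleContinuousLinearMap ℂ (fun _ : ℕ => ℂ) 2 n).comp
        (a • evalCLM ℂ (fun _ : ℕ => ℂ) 2 n) := by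
    ext x m
    rw [multiplier_apply]
    obtain rfl | h := eq_or_ne m n
    · simp [evalCLM]
    · simp [h]
  rw [h]
  exact (isCompactOperator_of_locallyCompactSpace_dom
    (a • evalCLM ℂ (fun _ : ℕ => ℂ) 2 n)).clm_comp
      (singleContinuousLinearMap ℂ (fun _ : ℕ => ℂ) 2 n)

open Filter Topology in
/-- A sequence tending to `0` is the limit in `ℓ∞` of its truncations. -/
theorem tendsto_sum_single_of_tendsto_zero {f : lp (fun _ : ℕ => ℂ) ∞}
    (hf : Tendsto (⇑f) atTop (𝓝 0)) :
    Tendsto (fun N => ∑ n ∈ Finset.range N, lp.single ∞ n (f n)) atTop (𝓝 f) := by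
  rw [Metric.tendsto_atTop] at hf ⊢
  intro ε hε
  obtain ⟨N, hN⟩ := hf (ε / 2) (half_pos hε)
  refine ⟨N, fun k hk => ?_⟩
  rw [dist_eq_norm]
  refine (norm_le_of_forall_le (half_pos hε).le fun m => ?_).trans_lt (half_lt_self hε)
  have hsum : (∑ n ∈ Finset.range k, lp.single ∞ n (f n) : lp (fun _ : ℕ => ℂ) ∞) m =
      if m < k then f m else 0 := by
    calc
      _ = ∑ n ∈ Finset.range k, (lp.single ∞ n (f n) : lp (fun _ : ℕ => ℂ) ∞) m :=
        map_sum (evalₗ (𝕜 := ℂ) (fun _ : ℕ => ℂ) ∞ m) _ _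
      _ = _ := by simp [Pi.single_apply]
  rw [coeFn_sub, Pi.sub_apply, hsum]
  split_ifs with hm
  · simpa using (half_pos hε).le
  · simpa using (hN m (by omega)).le

open Filter Topology in
theorem isCompactOperator_multiplier {f : lp (fun _ : ℕ => ℂ) ∞}
    (hf : Tendsto (⇑f) atTop (𝓝 0)) : IsCompactOperator (multiplier f) := by
  refine isCompactOperator_of_tendsto
    ((multiplier.continuous.tendsto f).comp (tendsto_sum_single_of_tendsto_zero hf))
    (Eventually.of_forall fun N => ?_)
  rw [Function.comp_apply, map_sum]
  refine Finset.sum_induction _ (fun T : _ →L[ℂ] _ => IsCompactOperator T)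
    (fun _ _ hS hT => hS.add hT) isCompactOperator_zero
    fun n _ => isCompactOperator_multiplier_single n (f n)

end lp

namespace Orthonormal

variable {E : Type*} [NormedAddCommGroup E] [InnerProductSpace ℂ E] {v : ℕ → E}

/-- The diagonal coefficients of an operator along an orthonormal sequence. -/
noncomputable def diagonalCoeff (hv : Orthonormal ℂ v) :
    (E →L[ℂ] E) →L[ℂ] lp (fun _ : ℕ => ℂ) ∞ :=
  have bound (T : E →L[ℂ] E) (n : ℕ) : ‖inner ℂ (v n) (T (v n))‖ ≤ ‖T‖ := by
    refine (norm_inner_le_norm _ _).trans ?_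
    simpa [hv.1] using T.le_opNorm (v n)
  LinearMap.mkContinuous
    { toFun T := ⟨fun n => inner ℂ (v n) (T (v n)),
        memℓp_infty ⟨‖T‖, Set.forall_mem_range.2 (bound T)⟩⟩
      map_add' _ _ := by ext; exact inner_add_right _ _ _
      map_smul' _ _ := by ext; exact inner_smul_right _ _ _ }
    1 fun T => by
      rw [one_mul]
      exact lp.norm_le_of_forall_le (norm_nonneg T) (bound T)

theorem diagonalCoeff_apply (hv : Orthonormal ℂ v) (T : E →L[ℂ] E) (n : ℕ) :
    hv.diagonalCoeff T n = inner ℂ (v n) (T (v n)) :=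
  rfl

variable [CompleteSpace E]

/-- The isometry of `ℓ²` into `E` determined by an orthonormal sequence. -/
noncomputable def l2Isometry (hv : Orthonormal ℂ v) : lp (fun _ : ℕ => ℂ) 2 →ₗᵢ[ℂ] E :=
  hv.orthogonalFamily.linearIsometry

theorem l2Isometry_single (hv : Orthonormal ℂ v) (n : ℕ) (a : ℂ) :
    hv.l2Isometry (lp.single 2 n a) = a • v n := by
  simp [l2Isometry]

/-- The operator that is diagonal along an orthonormal sequence, with prescribed bounded
coefficients, and that vanishes on its orthogonal complement. -/
noncomputable def diagonal (hv : Orthonormal ℂ v) :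
    lp (fun _ : ℕ => ℂ) ∞ →L[ℂ] (E →L[ℂ] E) :=
  (ContinuousLinearMap.postcomp E hv.l2Isometry.toContinuousLinearMap).comp
    ((ContinuousLinearMap.precomp (lp (fun _ : ℕ => ℂ) 2)
      (ContinuousLinearMap.adjoint hv.l2Isometry.toContinuousLinearMap)).comp lp.multiplier)

theorem diagonal_eq (hv : Orthonormal ℂ v) (f : lp (fun _ : ℕ => ℂ) ∞) :
    hv.diagonal f = hv.l2Isometry.toContinuousLinearMap.comp ((lp.multiplier f).comp
      (ContinuousLinearMap.adjoint hv.l2Isometry.toContinuousLinearMap)) :=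
  rfl

theorem adjoint_l2Isometry_apply (hv : Orthonormal ℂ v) (n : ℕ) :
    ContinuousLinearMap.adjoint hv.l2Isometry.toContinuousLinearMap (v n) = lp.single 2 n 1 := by
  have h := (ContinuousLinearMap.norm_map_iff_adjoint_comp_self
    hv.l2Isometry.toContinuousLinearMap).1 hv.l2Isometry.norm_map
  have hn : hv.l2Isometry.toContinuousLinearMap (lp.single 2 n 1) = v n := by
    simp [l2Isometry_single]
  rw [← hn]
  exact DFunLike.congr_fun h (lp.single 2 n 1)

theorem diagonal_apply (hv : Orthonormal ℂ v) (f : lp (fun _ : ℕ => ℂ) ∞) (n : ℕ) :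
    hv.diagonal f (v n) = f n • v n := by
  simp [diagonal_eq, adjoint_l2Isometry_apply, lp.multiplier_single, l2Isometry_single]

theorem diagonalCoeff_diagonal (hv : Orthonormal ℂ v) (f : lp (fun _ : ℕ => ℂ) ∞) :
    hv.diagonalCoeff (hv.diagonal f) = f := by
  ext n
  simp [diagonalCoeff_apply, diagonal_apply, hv.1]

open Filter Topology in
theorem isCompactOperator_diagonal (hv : Orthonormal ℂ v) {f : lp (fun _ : ℕ => ℂ) ∞}
    (hf : Tendsto (⇑f) atTop (𝓝 0)) : IsCompactOperator (hv.diagonal f) :=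
  ((lp.isCompactOperator_multiplier hf).comp_clm _).clm_comp
    hv.l2Isometry.toContinuousLinearMap

end Orthonormal

/-- Let `H` be an infinite dimensional separable complex Hilbert space.  If there is
a continuous linear projection `P` of `L(H)` onto the subspace of compact operators, then there
is a continuous linear projection `ρ` of `ℓ∞` onto `c₀`: if the compact operators are
complemented in `L(H)`, then `c₀` is complemented in `ℓ∞`. -/
theorem stmt_19 {H : Type*} [NormedAddCommGroup H] [InnerProductSpace ℂ H] [CompleteSpace H]
    [TopologicalSpace.SeparableSpace H] (hinf : ¬ FiniteDimensional ℂ H)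
    (P : (H →L[ℂ] H) →L[ℂ] (H →L[ℂ] H)) (hP : P.comp P = P)
    (hPrange : Set.range P = {T : H →L[ℂ] H | IsCompactOperator ⇑T}) :
    ∃ ρ : lp (fun _ : ℕ => ℂ) ∞ →L[ℂ] lp (fun _ : ℕ => ℂ) ∞,
      ρ.comp ρ = ρ ∧
      Set.range ρ =
        {f : lp (fun _ : ℕ => ℂ) ∞ | Filter.Tendsto (⇑f) Filter.atTop (nhds 0)} := by
  obtain ⟨v, hv⟩ := exists_orthonormal_nat hinf
  have hcompact (T : H →L[ℂ] H) : IsCompactOperator (P T) := by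
    have h : P T ∈ Set.range P := ⟨T, rfl⟩
    rwa [hPrange] at h
  have hfix (T : H →L[ℂ] H) (hT : IsCompactOperator T) : P T = T := by
    have h : T ∈ Set.range P := by rwa [hPrange]
    obtain ⟨S, rfl⟩ := h
    exact DFunLike.congr_fun hP S
  let ρ := hv.diagonalCoeff.comp (P.comp hv.diagonal)
  have hlim (f) : Filter.Tendsto (⇑(ρ f)) Filter.atTop (nhds 0) :=
    (hcompact (hv.diagonal f)).tendsto_inner_orthonormal hv
  have hid (f : lp (fun _ : ℕ => ℂ) ∞) (hf : Filter.Tendsto (⇑f) Filter.atTop (nhds 0)) :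
      ρ f = f := by
    simp [ρ, hfix _ (hv.isCompactOperator_diagonal hf), hv.diagonalCoeff_diagonal]
  refine ⟨ρ, ContinuousLinearMap.ext fun f => hid _ (hlim f), Set.ext fun f => ⟨?_, ?_⟩⟩
  · rintro ⟨g, rfl⟩
    exact hlim g
  · exact fun hf => ⟨f, hid f hf⟩
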